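/- In a multi-player perfect-information game with probabilistic transitions, countable state space, nonempty finite action sets, and bounded continuous payoff functions, for every continuous and bounded function F : ℝ^N → ℝ there exists a Nash equilibrium σ* with the following property: for every player i ∈ N and every strategy τ_i of player i with u_i(τ_i,σ*_{-i}) = u_i(σ*), one has F((u_j(σ*))_{j∈N}) ≤ F((u_j(τ_i,σ*_{-i}))_{j∈N}). -/

import Mathlib

open MeasureTheory

/-- A multi-player perfect-information game with probabilistic transitions:
a set of players `N`, a state space `S` with initial state `init`, a controlling
player `ctrl s` and a nonempty finite action set `act s` for every state `s`, and
a transition probability measure `q s a` for every state `s` and action `a`.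
The supports of the transition measures are mutually disjoint and every state is
reachable from the initial state, so every state is reached from `init` via
exactly one finite history (states correspond bijectively to histories). -/
structure PGame (N S A : Type*) where
  init : S
  ctrl : S → N
  act : S → Finset A
  act_nonempty : ∀ s, (act s).Nonempty
  q : S → A → PMF S
  unique_pred : ∀ z s a s' a', a ∈ act s → a' ∈ act s' →
    z ∈ (q s a).support → z ∈ (q s' a').support → s = s' ∧ a = a'
  init_not_succ : ∀ s a, a ∈ act s → init ∉ (q s a).support
  reach : ∀ z, Relation.ReflTransGen (fun s t => ∃ a ∈ act s, t ∈ (q s a).support) init z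

namespace PGame

variable {N S A : Type*} (G : PGame N S A)

/-- A play: an infinite alternating sequence of states and actions, starting at the
initial state, choosing legal actions and moving to successor states. -/
def IsPlay (p : ℕ → S × A) : Prop :=
  (p 0).1 = G.init ∧
    ∀ m, (p m).2 ∈ G.act (p m).1 ∧ (p (m + 1)).1 ∈ (G.q (p m).1 (p m).2).support

/-- The set of plays of the game. -/
def Play : Type _ := { p : ℕ → S × A // G.IsPlay p }

/-- The set of plays carries the topology generated by the cylinder sets, i.e. the
topology induced by the product of the discrete topologies. -/
instance : TopologicalSpace G.Play :=
  letI : TopologicalSpace S := ⊥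
  letI : TopologicalSpace A := ⊥
  inferInstanceAs (TopologicalSpace { p : ℕ → S × A // G.IsPlay p })

/-- The Borel σ-algebra on plays. -/
instance : MeasurableSpace G.Play := borel G.Play

/-- A strategy of player `i`: a choice of a legal action in every state controlled
by `i`. -/
def Strat (i : N) : Type _ := { f : S → A // ∀ s, G.ctrl s = i → f s ∈ G.act s }

/-- A strategy profile. -/
def Profile : Type _ := ∀ i : N, G.Strat i

/-- The profile `σ` with player `i`'s strategy replaced by `τi`. -/
noncomputable def comb (i : N) (τi : G.Strat i) (σ : G.Profile) : G.Profile :=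
  haveI := Classical.decEq N
  Function.update σ i τi

/-- The action that profile `σ` plays in state `s`. -/
def playFun (σ : G.Profile) (s : S) : A := (σ (G.ctrl s)).1 s

/-- The cylinder set of plays agreeing with the play `p0` on the first `n`
coordinates. -/
def cylSet (p0 : G.Play) (n : ℕ) : Set G.Play := { p : G.Play | ∀ m < n, p.1 m = p0.1 m }

open Classical in
/-- `μ` is the family of Borel probability measures on plays induced by the strategy
profiles via the Ionescu–Tulcea construction applied to `q`; it is uniquely
characterized by the probabilities it assigns to the cylinder sets: actions are
chosen deterministically according to the profile and states are drawn from the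
transition probabilities. -/
def IsInducedMeasure (μ : G.Profile → Measure G.Play) : Prop :=
  (∀ σ, IsProbabilityMeasure (μ σ)) ∧
    ∀ (σ : G.Profile) (p0 : G.Play) (n : ℕ),
      μ σ (G.cylSet p0 n) =
        ∏ m ∈ Finset.range n,
          ((if (p0.1 m).2 = G.playFun σ (p0.1 m).1 then 1 else 0) *
            (if m + 1 < n then G.q (p0.1 m).1 (p0.1 m).2 ((p0.1 (m + 1)).1) else 1))

/-- Expected payoff of player `i` under the profile `σ`: the integral of `u i`
against the induced measure. -/
noncomputable def epay (μ : G.Profile → Measure G.Play) (u : N → G.Play → ℝ)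
    (σ : G.Profile) (i : N) : ℝ :=
  ∫ p, u i p ∂(μ σ)

/-- Nash equilibrium: no player can improve his expected payoff by a unilateral
deviation. -/
def IsNash (μ : G.Profile → Measure G.Play) (u : N → G.Play → ℝ) (σ : G.Profile) : Prop :=
  ∀ (i : N) (τi : G.Strat i), G.epay μ u (G.comb i τi σ) i ≤ G.epay μ u σ i

/-- Secure equilibrium: a Nash equilibrium such that no player `i` has a deviation
keeping his own expected payoff equal, making all opponents weakly worse off, and
making some opponent strictly worse off. -/
def IsSecure (μ : G.Profile → Measure G.Play) (u : N → G.Play → ℝ) (σ : G.Profile) : Prop :=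
  G.IsNash μ u σ ∧
    ¬ ∃ (i : N) (τi : G.Strat i),
        G.epay μ u (G.comb i τi σ) i = G.epay μ u σ i ∧
        (∀ j : N, j ≠ i → G.epay μ u (G.comb i τi σ) j ≤ G.epay μ u σ j) ∧
        (∃ k : N, k ≠ i ∧ G.epay μ u (G.comb i τi σ) k < G.epay μ u σ k)

end PGame

namespace PGame

open Filter Topology

section Tools

variable {S : Type*}

/-- Expectation of a real function under a PMF. -/
noncomputable def ex (P : PMF S) (w : S → ℝ) : ℝ := ∑' z, (P z).toReal * w z

lemma summable_toReal (P : PMF S) : Summable (fun z => (P z).toReal) :=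
  ENNReal.summable_toReal (by rw [P.tsum_coe]; simp)

lemma tsum_toReal (P : PMF S) : ∑' z, (P z).toReal = 1 := by
  rw [← ENNReal.tsum_toReal_eq (fun z => P.apply_ne_top z), P.tsum_coe]; simp

lemma ex_summable (P : PMF S) {w : S → ℝ} {K : ℝ} (h : ∀ z, |w z| ≤ K) :
    Summable (fun z => (P z).toReal * w z) := by
  refine Summable.of_norm_bounded (g := fun z => (P z).toReal * K)
    ((summable_toReal P).mul_right K) (fun z => ?_)
  rw [norm_mul, Real.norm_of_nonneg ENNReal.toReal_nonneg]
  exact mul_le_mul_of_nonneg_left (h z) ENNReal.toReal_nonneg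

lemma ex_const (P : PMF S) (c : ℝ) : ex P (fun _ => c) = c := by
  unfold ex; rw [tsum_mul_right, tsum_toReal, one_mul]

lemma ex_congr (P : PMF S) {w w' : S → ℝ} (h : ∀ z ∈ P.support, w z = w' z) :
    ex P w = ex P w' := by
  unfold ex
  refine tsum_congr (fun z => ?_)
  by_cases hz : z ∈ P.support
  · rw [h z hz]
  · rw [PMF.mem_support_iff, not_not] at hz
    simp [hz]

lemma ex_mono (P : PMF S) {w w' : S → ℝ} {K : ℝ} (h : ∀ z, |w z| ≤ K) (h' : ∀ z, |w' z| ≤ K)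
    (hle : ∀ z ∈ P.support, w z ≤ w' z) : ex P w ≤ ex P w' := by
  unfold ex
  refine Summable.tsum_le_tsum (fun z => ?_) (ex_summable P h) (ex_summable P h')
  by_cases hz : z ∈ P.support
  · exact mul_le_mul_of_nonneg_left (hle z hz) ENNReal.toReal_nonneg
  · rw [PMF.mem_support_iff, not_not] at hz
    simp [hz]

lemma ex_eq_imp (P : PMF S) {w w' : S → ℝ} {K : ℝ} (h : ∀ z, |w z| ≤ K) (h' : ∀ z, |w' z| ≤ K)
    (hle : ∀ z ∈ P.support, w z ≤ w' z) (heq : ex P w' ≤ ex P w) :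
    ∀ z ∈ P.support, w z = w' z := by
  intro z hz
  by_contra hne
  have hlt : w z < w' z := lt_of_le_of_ne (hle z hz) hne
  have hpos : 0 < (P z).toReal := ENNReal.toReal_pos hz (P.apply_ne_top z)
  have : ex P w < ex P w' := by
    unfold ex
    refine Summable.tsum_lt_tsum (i := z) (fun y => ?_) (mul_lt_mul_of_pos_left hlt hpos)
      (ex_summable P h) (ex_summable P h')
    by_cases hy : y ∈ P.support
    · exact mul_le_mul_of_nonneg_left (hle y hy) ENNReal.toReal_nonneg
    · rw [PMF.mem_support_iff, not_not] at hy
      simp [hy]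
  linarith

lemma ex_tendsto (P : PMF S) {ι : Type*} {l : Filter ι} {w : ι → S → ℝ} {w' : S → ℝ} {K : ℝ}
    (h : ∀ n z, |w n z| ≤ K) (hlim : ∀ z, Tendsto (fun n => w n z) l (𝓝 (w' z))) :
    Tendsto (fun n => ex P (w n)) l (𝓝 (ex P w')) := by
  unfold ex
  refine tendsto_tsum_of_dominated_convergence (bound := fun z => (P z).toReal * K)
    ((summable_toReal P).mul_right K) (fun z => (hlim z).const_mul _) (Eventually.of_forall ?_)
  intro n z
  rw [norm_mul, Real.norm_of_nonneg ENNReal.toReal_nonneg]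
  exact mul_le_mul_of_nonneg_left (h n z) ENNReal.toReal_nonneg

/-- Knaster–Tarski on an order interval of real functions. -/
lemma fixpoint (B : (S → ℝ) → (S → ℝ)) (lo hi : S → ℝ) (hlh : lo ≤ hi)
    (hmono : ∀ x y, lo ≤ x → x ≤ y → y ≤ hi → B x ≤ B y)
    (hlo : lo ≤ B lo) (hhi : B hi ≤ hi) : ∃ x, lo ≤ x ∧ x ≤ hi ∧ B x = x := by
  have : Fact (lo ≤ hi) := ⟨hlh⟩
  let f : Set.Icc lo hi →o Set.Icc lo hi :=
    { toFun := fun x => ⟨B x.1, hlo.trans (hmono _ _ le_rfl x.2.1 x.2.2),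
        (hmono _ _ x.2.1 x.2.2 le_rfl).trans hhi⟩
      monotone' := fun x y hxy => hmono x.1 y.1 x.2.1 hxy y.2.2 }
  refine ⟨(OrderHom.lfp f).1, (OrderHom.lfp f).2.1, (OrderHom.lfp f).2.2, ?_⟩
  exact congrArg Subtype.val (OrderHom.map_lfp f)

lemma ultra_lim (x : ℕ → ℝ) {K : ℝ} (h : ∀ n, |x n| ≤ K) :
    ∃ y, Tendsto x (hyperfilter ℕ : Filter ℕ) (𝓝 y) := by
  obtain ⟨y, -, hy⟩ := (isCompact_Icc (a := -K) (b := K)).ultrafilter_le_nhds'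
    ((hyperfilter ℕ).map x) (by
      change ∀ᶠ n in (hyperfilter ℕ : Filter ℕ), x n ∈ Set.Icc (-K) K
      exact Eventually.of_forall fun n => abs_le.1 (h n))
  exact ⟨y, hy⟩

lemma ultra_choice {A : Type*} (C : Finset A) (P : A → ℕ → Prop)
    (h : ∀ᶠ n in (hyperfilter ℕ : Filter ℕ), ∃ a ∈ C, P a n) :
    ∃ a ∈ C, ∀ᶠ n in (hyperfilter ℕ : Filter ℕ), P a n :=
  (Ultrafilter.eventually_exists_mem_iff (f := hyperfilter ℕ) (is := (C : Set A))
    C.finite_toSet).1 h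

end Tools

end PGame

namespace PGame

open Filter Topology

section Plays

variable {N S A : Type*} (G : PGame N S A)

lemma history_unique {p p' : ℕ → S × A} (hp : G.IsPlay p) (hp' : G.IsPlay p') :
    ∀ n m, (p n).1 = (p' m).1 → n = m ∧ ∀ k < n, p k = p' k := by
  intro n
  induction n with
  | zero =>
    intro m h
    cases m with
    | zero => exact ⟨rfl, fun k hk => absurd hk (by omega)⟩
    | succ m =>
      exfalso
      have h1 := hp'.2 m
      rw [← h, hp.1] at h1
      exact G.init_not_succ _ _ h1.1 h1.2
  | succ n ih =>
    intro m h
    cases m with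
    | zero =>
      exfalso
      have h1 := hp.2 n
      rw [h, hp'.1] at h1
      exact G.init_not_succ _ _ h1.1 h1.2
    | succ m =>
      have h1 := hp.2 n
      have h2 := hp'.2 m
      rw [h] at h1
      obtain ⟨e1, e2⟩ := G.unique_pred _ _ _ _ _ h1.1 h2.1 h1.2 h2.2
      obtain ⟨rfl, h3⟩ := ih m e1
      refine ⟨rfl, fun k hk => ?_⟩
      rcases Nat.lt_succ_iff_lt_or_eq.1 hk with hk | rfl
      · exact h3 k hk
      · exact Prod.ext e1 e2

/-- Some continuation of the play from state `t`. -/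
noncomputable def contSt (t : S) : ℕ → S
  | 0 => t
  | n + 1 => (G.q (contSt t n) (G.act_nonempty (contSt t n)).choose).support_nonempty.choose

lemma exists_ext {p : ℕ → S × A} (hp : G.IsPlay p) (n : ℕ) (a : A) (ha : a ∈ G.act (p n).1)
    (t : S) (ht : t ∈ (G.q (p n).1 a).support) :
    ∃ p', G.IsPlay p' ∧ (∀ m < n, p' m = p m) ∧ p' n = ((p n).1, a) ∧ (p' (n + 1)).1 = t := by
  let p' : ℕ → S × A := fun m => if m < n then p m else if m = n then ((p n).1, a) else
    (G.contSt t (m - (n + 1)), (G.act_nonempty (G.contSt t (m - (n + 1)))).choose)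
  have h1 : ∀ m, m < n → p' m = p m := fun m hm => by simp only [p', if_pos hm]
  have h2 : p' n = ((p n).1, a) := by simp [p']
  have h3 : ∀ k, p' (n + 1 + k) =
      (G.contSt t k, (G.act_nonempty (G.contSt t k)).choose) := fun k => by
    simp only [p']
    rw [if_neg (by omega), if_neg (by omega), show n + 1 + k - (n + 1) = k by omega]
  have h1' : ∀ m, m ≤ n → (p' m).1 = (p m).1 := fun m hm => by
    rcases hm.lt_or_eq with hm | rfl
    · rw [h1 m hm]
    · rw [h2]
  refine ⟨p', ⟨?_, fun m => ?_⟩, h1, h2, ?_⟩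
  · rw [h1' 0 (by omega)]; exact hp.1
  · rcases lt_trichotomy m n with hm | rfl | hm
    · rw [h1 m hm, h1' (m + 1) (by omega)]; exact hp.2 m
    · rw [h2]
      refine ⟨ha, ?_⟩
      rw [show m + 1 = m + 1 + 0 by omega, h3]
      exact ht
    · obtain ⟨k, rfl⟩ : ∃ k, m = n + 1 + k := ⟨m - (n + 1), by omega⟩
      rw [h3, show n + 1 + k + 1 = n + 1 + (k + 1) by omega, h3]
      refine ⟨(G.act_nonempty (G.contSt t k)).choose_spec, ?_⟩
      exact (G.q (G.contSt t k) (G.act_nonempty (G.contSt t k)).choose).support_nonempty.choose_spec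
  · rw [show n + 1 = n + 1 + 0 by omega, h3]; rfl

lemma exists_ext' {p : ℕ → S × A} (hp : G.IsPlay p) (n : ℕ) (a : A) (ha : a ∈ G.act (p n).1) :
    ∃ p', G.IsPlay p' ∧ (∀ m < n, p' m = p m) ∧ p' n = ((p n).1, a) := by
  obtain ⟨t, ht⟩ := (G.q (p n).1 a).support_nonempty
  obtain ⟨p', h1, h2, h3, -⟩ := G.exists_ext hp n a ha t ht
  exact ⟨p', h1, h2, h3⟩

lemma exists_play_through (z : S) : ∃ p, G.IsPlay p ∧ ∃ n, (p n).1 = z := by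
  induction G.reach z with
  | refl =>
    let p : ℕ → S × A := fun m =>
      (G.contSt G.init m, (G.act_nonempty (G.contSt G.init m)).choose)
    refine ⟨p, ⟨rfl, fun m => ⟨(G.act_nonempty (G.contSt G.init m)).choose_spec, ?_⟩⟩, 0, rfl⟩
    exact (G.q (G.contSt G.init m)
      (G.act_nonempty (G.contSt G.init m)).choose).support_nonempty.choose_spec
  | tail _ h ih =>
    obtain ⟨p, hp, n, rfl⟩ := ih
    obtain ⟨a, ha, ht⟩ := h
    obtain ⟨p', h1, -, -, h4⟩ := G.exists_ext hp n a ha _ ht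
    exact ⟨p', h1, n + 1, h4⟩

lemma exists_phase {X : Type*} (x0 : X) (nx : X → S → A → X) :
    ∃ ph : S → X, ph G.init = x0 ∧
      ∀ s, ∀ a ∈ G.act s, ∀ z ∈ (G.q s a).support, ph z = nx (ph s) s a := by
  let fold : (ℕ → S × A) → ℕ → X := fun p n =>
    Nat.rec x0 (fun k x => nx x (p k).1 (p k).2) n
  have hfold : ∀ p n, fold p (n + 1) = nx (fold p n) (p n).1 (p n).2 := fun p n => rfl
  have hcongr : ∀ p p' n, (∀ k < n, p k = p' k) → fold p n = fold p' n := by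
    intro p p' n
    induction n with
    | zero => intro _; rfl
    | succ n ih =>
      intro hk
      rw [hfold, hfold, ih (fun k hk' => hk k (by omega)), hk n (by omega)]
  choose p hp n hn using G.exists_play_through
  have key : ∀ (p' : ℕ → S × A) (m : ℕ), G.IsPlay p' →
      fold (p (p' m).1) (n (p' m).1) = fold p' m := by
    intro p' m hp'
    obtain ⟨h1, h2⟩ := G.history_unique (hp (p' m).1) hp' _ m (hn (p' m).1)
    rw [hcongr _ _ _ h2, h1]
  refine ⟨fun z => fold (p z) (n z), ?_, ?_⟩
  · have := key (p G.init) 0 (hp _)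
    rw [(hp G.init).1] at this
    exact this
  · intro s a ha z hz
    have hs := hn s
    obtain ⟨p', h1, h2, h3, h4⟩ := G.exists_ext (hp s) (n s) a (by rwa [hs]) z (by rwa [hs])
    have k1 := key p' (n s + 1) h1
    have k2 := key p' (n s) h1
    rw [h4, hfold] at k1
    rw [h3] at k1 k2
    dsimp only at k1 k2 ⊢
    rw [hs] at k1 k2
    rw [k1, k2]

end Plays

end PGame

namespace PGame

open Filter Topology

variable {N S A : Type*} (G : PGame N S A)

/-- Bounds for the continuation payoffs. -/
structure Bds (L U : S → ℝ) (K : ℝ) : Prop where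
  lo : ∀ s, -K ≤ L s
  hi : ∀ s, U s ≤ K
  le : L ≤ U
  mono : ∀ s a z, a ∈ G.act s → z ∈ (G.q s a).support → L s ≤ L z ∧ U z ≤ U s

variable {G}

lemma Bds.abs {L U : S → ℝ} {K : ℝ} (h : G.Bds L U K) {w : S → ℝ} (h1 : L ≤ w) (h2 : w ≤ U) :
    ∀ z, |w z| ≤ K := fun z =>
  abs_le.2 ⟨(h.lo z).trans (h1 z), (h2 z).trans (h.hi z)⟩

lemma Bds.ex_hi {L U : S → ℝ} {K : ℝ} (h : G.Bds L U K) {s : S} {a : A} (ha : a ∈ G.act s) :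
    ex (G.q s a) U ≤ U s := by
  have hK := h.abs h.le le_rfl
  calc ex (G.q s a) U ≤ ex (G.q s a) (fun _ => U s) :=
        ex_mono _ hK (fun _ => hK s) (fun z hz => (h.mono s a z ha hz).2)
    _ = U s := ex_const _ _

lemma Bds.ex_lo {L U : S → ℝ} {K : ℝ} (h : G.Bds L U K) {s : S} {a : A} (ha : a ∈ G.act s) :
    L s ≤ ex (G.q s a) L := by
  have hK := h.abs le_rfl h.le
  calc L s = ex (G.q s a) (fun _ => L s) := (ex_const _ _).symm
    _ ≤ ex (G.q s a) L :=
        ex_mono _ (fun _ => hK s) hK (fun z hz => (h.mono s a z ha hz).1)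

/-- Between a subharmonic and a superharmonic function there is a harmonic one. -/
lemma exists_harmonic {L U : S → ℝ} {K : ℝ} (h : G.Bds L U K) (f : S → A)
    {lo hi : S → ℝ} (h1 : L ≤ lo) (h2 : lo ≤ hi) (h3 : hi ≤ U)
    (hlo : ∀ s, lo s ≤ ex (G.q s (f s)) lo) (hhi : ∀ s, ex (G.q s (f s)) hi ≤ hi s) :
    ∃ w, lo ≤ w ∧ w ≤ hi ∧ ∀ s, ex (G.q s (f s)) w = w s := by
  obtain ⟨w, hw1, hw2, hw3⟩ := fixpoint (fun w s => ex (G.q s (f s)) w) lo hi h2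
    (fun x y hx hxy hy s => ex_mono _ (h.abs (h1.trans hx) (hxy.trans (hy.trans h3)))
      (h.abs (h1.trans (hx.trans hxy)) (hy.trans h3)) (fun z _ => hxy z)) hlo hhi
  exact ⟨w, hw1, hw2, fun s => congrFun hw3 s⟩

/-- `v` solves the optimality equations of player `i` when actions are restricted to `C`. -/
def IsVal (G : PGame N S A) (C : S → Finset A) (i : N) (v : S → ℝ) : Prop :=
  ∀ s, (∃ a ∈ C s, ex (G.q s a) v = v s) ∧
    (G.ctrl s = i → ∀ a ∈ C s, ex (G.q s a) v ≤ v s) ∧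
    (G.ctrl s ≠ i → ∀ a ∈ C s, v s ≤ ex (G.q s a) v)

open Classical in
lemma exists_val {L U : S → ℝ} {K : ℝ} (h : G.Bds L U K) (C : S → Finset A)
    (hC : ∀ s, (C s).Nonempty) (hCa : ∀ s, C s ⊆ G.act s) (i : N)
    {lo : S → ℝ} (h1 : L ≤ lo) (h2 : lo ≤ U)
    (hi : ∀ s, G.ctrl s = i → ∃ a ∈ C s, lo s ≤ ex (G.q s a) lo)
    (hni : ∀ s, G.ctrl s ≠ i → ∀ a ∈ C s, lo s ≤ ex (G.q s a) lo) :
    ∃ v, lo ≤ v ∧ v ≤ U ∧ G.IsVal C i v := by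
  obtain ⟨v, hv1, hv2, hv3⟩ := fixpoint
    (fun w s => if G.ctrl s = i then (C s).sup' (hC s) (fun a => ex (G.q s a) w)
      else (C s).inf' (hC s) (fun a => ex (G.q s a) w)) lo U h2
    (fun x y hx hxy hy s => by
      have hh : ∀ a, ex (G.q s a) x ≤ ex (G.q s a) y := fun a =>
        ex_mono _ (h.abs (h1.trans hx) (hxy.trans hy)) (h.abs (h1.trans (hx.trans hxy)) hy)
          (fun z _ => hxy z)
      dsimp only
      split_ifs
      · exact Finset.sup'_mono_fun (fun a _ => hh a)
      · exact Finset.inf'_mono_fun (fun a _ => hh a))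
    (fun s => by
      dsimp only
      split_ifs with hs
      · obtain ⟨a, ha, hl⟩ := hi s hs
        exact hl.trans (Finset.le_sup' (fun a => ex (G.q s a) lo) ha)
      · exact Finset.le_inf' _ _ (hni s hs))
    (fun s => by
      dsimp only
      split_ifs with hs
      · exact Finset.sup'_le _ _ (fun a ha => h.ex_hi (hCa s ha))
      · obtain ⟨a, ha⟩ := hC s
        exact (Finset.inf'_le _ ha).trans (h.ex_hi (hCa s ha)))
  refine ⟨v, hv1, hv2, fun s => ?_⟩
  have hs := congrFun hv3 s
  split_ifs at hs with hc
  · refine ⟨?_, fun _ a ha => ?_, fun hn => absurd hc hn⟩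
    · obtain ⟨a, ha, he⟩ := Finset.exists_mem_eq_sup' (hC s) (fun a => ex (G.q s a) v)
      exact ⟨a, ha, by rw [← hs, he]⟩
    · rw [← hs]; exact Finset.le_sup' (fun a => ex (G.q s a) v) ha
  · refine ⟨?_, fun hn => absurd hn hc, fun _ a ha => ?_⟩
    · obtain ⟨a, ha, he⟩ := Finset.exists_mem_eq_inf' (hC s) (fun a => ex (G.q s a) v)
      exact ⟨a, ha, by rw [← hs, he]⟩
    · rw [← hs]; exact Finset.inf'_le (fun a => ex (G.q s a) v) ha

/-- The invariant of the iterated elimination. -/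
structure Inv (G : PGame N S A) (U T : N → S → ℝ) (x : (S → Finset A) × (N → S → ℝ)) :
    Prop where
  ne : ∀ s, (x.1 s).Nonempty
  sub : ∀ s, x.1 s ⊆ G.act s
  lo : ∀ i, T i ≤ x.2 i
  hi : ∀ i, x.2 i ≤ U i
  val : ∀ i, G.IsVal x.1 i (x.2 i)
  thr : ∀ s, ∀ a ∈ G.act s, a ∉ x.1 s → ex (G.q s a) (T (G.ctrl s)) < x.2 (G.ctrl s) s

open Classical in
lemma Inv.step {L U T : N → S → ℝ} {K : N → ℝ} (h : ∀ i, G.Bds (L i) (U i) (K i))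
    (hT : ∀ i, L i ≤ T i) {x : (S → Finset A) × (N → S → ℝ)} (hx : G.Inv U T x) :
    ∃ y, G.Inv U T y ∧ (∀ i, x.2 i ≤ y.2 i) ∧
      ∀ s, y.1 s = (x.1 s).filter (fun a => ex (G.q s a) (x.2 (G.ctrl s)) = x.2 (G.ctrl s) s) := by
  set C' : S → Finset A := fun s =>
    (x.1 s).filter (fun a => ex (G.q s a) (x.2 (G.ctrl s)) = x.2 (G.ctrl s) s) with hC'
  have hne : ∀ s, (C' s).Nonempty := fun s => by
    obtain ⟨a, ha, he⟩ := (hx.val (G.ctrl s) s).1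
    exact ⟨a, Finset.mem_filter.2 ⟨ha, he⟩⟩
  have hsub : ∀ s, C' s ⊆ G.act s := fun s => (Finset.filter_subset _ _).trans (hx.sub s)
  have hv : ∀ i, ∃ v, x.2 i ≤ v ∧ v ≤ U i ∧ G.IsVal C' i v := fun i => by
    refine exists_val (h i) C' hne hsub i ((hT i).trans (hx.lo i)) (hx.hi i) ?_ ?_
    · rintro s rfl
      obtain ⟨a, ha⟩ := hne s
      exact ⟨a, ha, (Finset.mem_filter.1 ha).2.ge⟩
    · intro s hs a ha
      exact (hx.val i s).2.2 hs a (Finset.mem_filter.1 ha).1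
  choose v hv1 hv2 hv3 using hv
  refine ⟨(C', v), ⟨hne, hsub, fun i => (hx.lo i).trans (hv1 i), hv2, hv3, ?_⟩, hv1, fun s => rfl⟩
  intro s a ha hna
  by_cases hax : a ∈ x.1 s
  · have h1 : ex (G.q s a) (x.2 (G.ctrl s)) < x.2 (G.ctrl s) s :=
      lt_of_le_of_ne ((hx.val _ s).2.1 rfl a hax)
        (fun he => hna (Finset.mem_filter.2 ⟨hax, he⟩))
    have h2 : ex (G.q s a) (T (G.ctrl s)) ≤ ex (G.q s a) (x.2 (G.ctrl s)) :=
      ex_mono _ ((h _).abs (hT _) ((hx.lo _).trans (hx.hi _)))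
        ((h _).abs ((hT _).trans (hx.lo _)) (hx.hi _)) (fun z _ => hx.lo _ z)
    exact (h2.trans_lt h1).trans_le (hv1 _ s)
  · exact (hx.thr s a ha hax).trans_le (hv1 _ s)

lemma exists_min_nat (f : ℕ → ℕ) : ∃ m, ∀ n, f m ≤ f n :=
  ⟨Function.argmin f, fun n => Function.argmin_le f n⟩

/-- The final properties of the elimination. -/
lemma exists_core {L U : N → S → ℝ} {K : N → ℝ} (h : ∀ i, G.Bds (L i) (U i) (K i)) :
    ∃ (C : S → Finset A) (v T : N → S → ℝ),
      (∀ s, (C s).Nonempty) ∧ (∀ s, C s ⊆ G.act s) ∧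
      (∀ i, L i ≤ T i) ∧ (∀ i, T i ≤ v i) ∧ (∀ i, v i ≤ U i) ∧
      (∀ i, G.IsVal G.act i (T i)) ∧ (∀ i, G.IsVal C i (v i)) ∧
      (∀ s, ∀ a ∈ C s, ex (G.q s a) (v (G.ctrl s)) = v (G.ctrl s) s) ∧
      (∀ s, ∀ a ∈ G.act s, a ∉ C s → ex (G.q s a) (T (G.ctrl s)) < v (G.ctrl s) s) := by
  have hT : ∀ i, ∃ v, L i ≤ v ∧ v ≤ U i ∧ G.IsVal G.act i v := fun i => by
    refine exists_val (h i) G.act G.act_nonempty (fun _ => subset_rfl) i le_rfl (h i).le ?_ ?_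
    · intro s _
      obtain ⟨a, ha⟩ := G.act_nonempty s
      exact ⟨a, ha, (h i).ex_lo ha⟩
    · intro s _ a ha
      exact (h i).ex_lo ha
  choose T hT1 hT2 hT3 using hT
  have h0 : G.Inv U T (G.act, T) :=
    ⟨G.act_nonempty, fun _ => subset_rfl, fun _ => le_rfl, hT2, hT3,
      fun s a ha hn => absurd ha hn⟩
  let X := {x : (S → Finset A) × (N → S → ℝ) // G.Inv U T x}
  choose nxt hn1 hn2 hn3 using fun x : X => x.2.step h hT1
  let seq : ℕ → X := fun n => Nat.rec ⟨_, h0⟩ (fun _ x => ⟨nxt x, hn1 x⟩) n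
  have hseq : ∀ n, (seq (n + 1)).1 = nxt (seq n) := fun n => rfl
  have hvm : ∀ i s, Monotone (fun n => (seq n).1.2 i s) := fun i s =>
    monotone_nat_of_le_succ (fun n => by
      rw [hseq]; exact hn2 (seq n) i s)
  have hCm : ∀ s, Antitone (fun n => (seq n).1.1 s) := fun s =>
    antitone_nat_of_succ_le (fun n => by
      rw [hseq, hn3]; exact Finset.filter_subset _ _)
  have habs : ∀ i n z, |(seq n).1.2 i z| ≤ K i := fun i n =>
    (h i).abs ((hT1 i).trans ((seq n).2.lo i)) ((seq n).2.hi i)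
  choose v hv using fun i s => ultra_lim (fun n => (seq n).1.2 i s) (fun n => habs i n s)
  have hle : ∀ i s n, (seq n).1.2 i s ≤ v i s := fun i s n => by
    refine ge_of_tendsto (hv i s) ?_
    have : ∀ᶠ m in (hyperfilter ℕ : Filter ℕ), n ≤ m :=
      (Nat.hyperfilter_le_atTop) (eventually_ge_atTop n)
    filter_upwards [this] with m hm using hvm i s hm
  have hvE : ∀ i s a, Tendsto (fun n => ex (G.q s a) ((seq n).1.2 i))
      (hyperfilter ℕ : Filter ℕ) (𝓝 (ex (G.q s a) (v i))) := fun i s a =>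
    ex_tendsto _ (habs i) (hv i)
  -- the sets stabilize
  have hstab : ∀ s, ∃ M, ∀ n, M ≤ n → (seq n).1.1 s = (seq M).1.1 s := fun s => by
    obtain ⟨M, hM⟩ := exists_min_nat (fun n => ((seq n).1.1 s).card)
    exact ⟨M, fun n hn => Finset.eq_of_subset_of_card_le (hCm s hn) (hM n)⟩
  choose M hM using hstab
  have hevM : ∀ s, ∀ᶠ n in (hyperfilter ℕ : Filter ℕ), M s ≤ n := fun s =>
    (Nat.hyperfilter_le_atTop) (eventually_ge_atTop (M s))
  refine ⟨fun s => (seq (M s)).1.1 s, v, T, fun s => (seq (M s)).2.ne s,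
    fun s => (seq (M s)).2.sub s, hT1, fun i s => ((seq 0).2.lo i s).trans (hle i s 0), ?_, hT3,
    ?_, ?_, ?_⟩
  · intro i s
    exact le_of_tendsto (hv i s) (Eventually.of_forall fun n => (seq n).2.hi i s)
  · intro i s
    refine ⟨?_, fun hs a ha => ?_, fun hs a ha => ?_⟩
    · obtain ⟨a, ha, he⟩ := ultra_choice ((seq (M s)).1.1 s)
        (fun a n => ex (G.q s a) ((seq n).1.2 i) = (seq n).1.2 i s) (by
          filter_upwards [hevM s] with n hn
          have := ((seq n).2.val i s).1
          rwa [hM s n hn] at this)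
      refine ⟨a, ha, tendsto_nhds_unique (hvE i s a) ((hv i s).congr' ?_)⟩
      filter_upwards [he] with n hn using hn.symm
    · refine le_of_tendsto_of_tendsto (hvE i s a) (hv i s) ?_
      filter_upwards [hevM s] with n hn
      exact ((seq n).2.val i s).2.1 hs a (by rwa [hM s n hn])
    · refine le_of_tendsto_of_tendsto (hv i s) (hvE i s a) ?_
      filter_upwards [hevM s] with n hn
      exact ((seq n).2.val i s).2.2 hs a (by rwa [hM s n hn])
  · intro s a ha
    refine tendsto_nhds_unique (hvE _ s a) ((hv _ s).congr' ?_)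
    filter_upwards [hevM s] with n hn
    have h1 : a ∈ (seq (n + 1)).1.1 s := by rwa [hM s (n + 1) (by omega)]
    rw [hseq, hn3] at h1
    exact (Finset.mem_filter.1 h1).2.symm
  · intro s a ha hna
    exact ((seq (M s)).2.thr s a ha hna).trans_le (hle _ s _)

end PGame

namespace PGame

open Filter Topology

variable {N S A : Type*} {G : PGame N S A}

/-- States reachable when actions are chosen according to `g`. -/
inductive Rch (G : PGame N S A) (g : S → A) : S → Prop
  | init : Rch G g G.init
  | step (s z : S) : Rch G g s → z ∈ (G.q s (g s)).support → Rch G g z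

/-- `J` is the payoff functional at the initial state. -/
def IsPay (G : PGame N S A) (L U : N → S → ℝ) (J : (S → A) → N → ℝ) : Prop :=
  ∀ f : S → A, (∀ s, f s ∈ G.act s) → ∀ i w, L i ≤ w → w ≤ U i →
    (∀ s, ex (G.q s (f s)) w = w s) → J f i = w G.init

section

variable {L U : N → S → ℝ} {K : N → ℝ} {J : (S → A) → N → ℝ}

lemma exists_harm (h : ∀ i, G.Bds (L i) (U i) (K i)) (f : S → A) (hf : ∀ s, f s ∈ G.act s)
    (i : N) : ∃ w, L i ≤ w ∧ w ≤ U i ∧ ∀ s, ex (G.q s (f s)) w = w s :=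
  exists_harmonic (h i) f le_rfl (h i).le le_rfl (fun s => (h i).ex_lo (hf s))
    (fun s => (h i).ex_hi (hf s))

open Classical in
lemma pay_congr (h : ∀ i, G.Bds (L i) (U i) (K i)) (hJ : G.IsPay L U J)
    {f g : S → A} (hf : ∀ s, f s ∈ G.act s) (hg : ∀ s, g s ∈ G.act s)
    (hfg : ∀ s, G.Rch g s → f s = g s) : J f = J g := by
  funext i
  obtain ⟨x, hx1, hx2, hx3⟩ := exists_harm h f hf i
  obtain ⟨y, hy1, hy2, hy3⟩ := exists_harm h g hg i
  rw [hJ f hf i x hx1 hx2 hx3]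
  rw [hJ g hg i (fun s => if G.Rch g s then x s else y s)]
  · simp [Rch.init]
  · intro s; dsimp only; split_ifs
    · exact hx1 s
    · exact hy1 s
  · intro s; dsimp only; split_ifs
    · exact hx2 s
    · exact hy2 s
  · intro s
    by_cases hs : G.Rch g s
    · rw [if_pos hs, ← hx3 s, hfg s hs]
      refine ex_congr _ (fun z hz => ?_)
      rw [if_pos (Rch.step s z hs hz)]
    · rw [if_neg hs, ← hy3 s]
      refine ex_congr _ (fun z hz => ?_)
      rw [if_neg]
      intro hz'
      cases hz' with
      | init => exact G.init_not_succ s _ (hg s) hz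
      | step s' _ hs' hz'' =>
        obtain ⟨rfl, -⟩ := G.unique_pred z s (g s) s' (g s') (hg s) (hg s') hz hz''
        exact hs hs'

lemma exists_min (h : ∀ i, G.Bds (L i) (U i) (K i)) (hJ : G.IsPay L U J)
    (C : S → Finset A) (hC : ∀ s, (C s).Nonempty) (hCa : ∀ s, C s ⊆ G.act s)
    (F : (N → ℝ) → ℝ) (hF : Continuous F) (hFb : ∃ B, ∀ x, |F x| ≤ B) :
    ∃ f : S → A, (∀ s, f s ∈ C s) ∧ ∀ g : S → A, (∀ s, g s ∈ C s) → F (J f) ≤ F (J g) := by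
  let R : Set ℝ := (fun f => F (J f)) '' {f : S → A | ∀ s, f s ∈ C s}
  have hRne : R.Nonempty := ⟨_, fun s => (hC s).choose, fun s => (hC s).choose_spec, rfl⟩
  have hRb : BddBelow R := by
    obtain ⟨B, hB⟩ := hFb
    refine ⟨-B, ?_⟩
    rintro _ ⟨f, -, rfl⟩
    exact (abs_le.1 (hB _)).1
  obtain ⟨r, -, hr, hrm⟩ := exists_seq_tendsto_sInf hRne hRb
  choose f hfC hfr using hrm
  choose w hw1 hw2 hw3 using fun n i => exists_harm h (f n) (fun s => hCa s (hfC n s)) i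
  have habs : ∀ i n z, |w n i z| ≤ K i := fun i n => (h i).abs (hw1 n i) (hw2 n i)
  choose x hx using fun i s => ultra_lim (fun n => w n i s) (fun n => habs i n s)
  choose g hgC hg using fun s => ultra_choice (C s) (fun a n => f n s = a)
    (Eventually.of_forall fun n => ⟨_, hfC n s, rfl⟩)
  have hgJ : ∀ i, J g i = x i G.init := fun i => by
    refine hJ g (fun s => hCa s (hgC s)) i (x i) ?_ ?_ ?_
    · exact fun s => ge_of_tendsto (hx i s) (Eventually.of_forall fun n => hw1 n i s)
    · exact fun s => le_of_tendsto (hx i s) (Eventually.of_forall fun n => hw2 n i s)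
    · intro s
      refine tendsto_nhds_unique (ex_tendsto (G.q s (g s)) (habs i) (hx i)) ((hx i s).congr' ?_)
      filter_upwards [hg s] with n hn
      rw [← hn, hw3]
  have hlim : Tendsto (fun n => F (J (f n))) (hyperfilter ℕ : Filter ℕ) (𝓝 (F (J g))) := by
    refine (hF.tendsto (J g)).comp (tendsto_pi_nhds.2 fun i => ?_)
    rw [hgJ i]
    refine (hx i G.init).congr fun n => ?_
    exact (hJ (f n) (fun s => hCa s (hfC n s)) i _ (hw1 n i) (hw2 n i) (hw3 n i)).symm
  have hlim2 : Tendsto (fun n => F (J (f n))) (hyperfilter ℕ : Filter ℕ) (𝓝 (sInf R)) := by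
    refine (hr.mono_left Nat.hyperfilter_le_atTop).congr fun n => ?_
    exact (hfr n).symm
  refine ⟨g, hgC, fun g' hg' => ?_⟩
  rw [tendsto_nhds_unique hlim hlim2]
  exact csInf_le hRb ⟨g', hg', rfl⟩

open Classical in
/-- The combinatorial core of the theorem. -/
theorem core_main (h : ∀ i, G.Bds (L i) (U i) (K i)) (hJ : G.IsPay L U J)
    (F : (N → ℝ) → ℝ) (hF : Continuous F) (hFb : ∃ B, ∀ x, |F x| ≤ B) :
    ∃ f : S → A, (∀ s, f s ∈ G.act s) ∧ ∀ (i : N) (g : S → A), (∀ s, g s ∈ G.act s) →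
      (∀ s, G.ctrl s ≠ i → g s = f s) →
      J g i ≤ J f i ∧ (J g i = J f i → F (J f) ≤ F (J g)) := by
  obtain ⟨C, v, T, hC, hCa, hLT, hTv, hvU, hT, hv, hCe, hCn⟩ := exists_core h
  obtain ⟨f0, hf0, hmin⟩ := exists_min h hJ C hC hCa F hF hFb
  have hLv : ∀ i, L i ≤ v i := fun i => (hLT i).trans (hTv i)
  have hf0a : ∀ s, f0 s ∈ G.act s := fun s => hCa s (hf0 s)
  have hH : ∀ i, ∃ w, v i ≤ w ∧ w ≤ U i ∧ ∀ s, ex (G.q s (f0 s)) w = w s := fun i => by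
    refine exists_harmonic (h i) f0 (hLv i) (hvU i) le_rfl (fun s => ?_)
      (fun s => (h i).ex_hi (hf0a s))
    by_cases hs : G.ctrl s = i
    · subst hs; exact (hCe s _ (hf0 s)).ge
    · exact (hv i s).2.2 hs _ (hf0 s)
  choose H hH1 hH2 hH3 using hH
  choose c hcC hce using fun i s => (hv i s).1
  choose t htA hte using fun i s => (hT i s).1
  let nx : Option (N × Bool) → S → A → Option (N × Bool) := fun x s a =>
    match x with
    | none => if a = f0 s then none else if a ∈ C s then some (G.ctrl s, false)
        else some (G.ctrl s, true)
    | some (j, false) => if G.ctrl s = j ∧ a ∉ C s then some (j, true) else some (j, false)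
    | some (j, true) => some (j, true)
  obtain ⟨ph, hph0, hph⟩ := exists_phase G none nx
  let fs : S → A := fun s =>
    match ph s with
    | none => f0 s
    | some (j, false) => if G.ctrl s = j then f0 s else c j s
    | some (j, true) => if G.ctrl s = j then f0 s else t j s
  have hfs_none : ∀ s, ph s = none → fs s = f0 s := fun s hs => by simp only [fs, hs]
  have hfs_soft : ∀ s j, ph s = some (j, false) → G.ctrl s ≠ j → fs s = c j s :=
    fun s j hs hj => by simp only [fs, hs, if_neg hj]
  have hfs_hard : ∀ s j, ph s = some (j, true) → G.ctrl s ≠ j → fs s = t j s :=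
    fun s j hs hj => by simp only [fs, hs, if_neg hj]
  have hfsa : ∀ s, fs s ∈ G.act s := fun s => by
    rcases hp : ph s with _ | ⟨j, b⟩
    · rw [hfs_none s hp]; exact hf0a s
    · by_cases hj : G.ctrl s = j
      · have : fs s = f0 s := by cases b <;> simp only [fs, hp, if_pos hj]
        rw [this]; exact hf0a s
      · cases b
        · rw [hfs_soft s j hp hj]; exact hCa s (hcC j s)
        · rw [hfs_hard s j hp hj]; exact htA j s
  have hJfs : J fs = J f0 := by
    refine pay_congr h hJ hfsa hf0a (fun s hs => hfs_none s ?_)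
    induction hs with
    | init => exact hph0
    | step s z hs hz ih => rw [hph s _ (hf0a s) z hz, ih]; simp [nx]
  refine ⟨fs, hfsa, fun i g hg hgi => ?_⟩
  rw [hJfs]
  let w : S → ℝ := fun s =>
    match ph s with
    | none => H i s
    | some (j, false) => if j = i then v i s else U i s
    | some (j, true) => if j = i then T i s else U i s
  have hLw : L i ≤ w := fun s => by
    simp only [w]; split
    · exact (hLv i s).trans (hH1 i s)
    · split_ifs; exacts [hLv i s, (h i).le s]
    · split_ifs; exacts [hLT i s, (h i).le s]
  have hwU : w ≤ U i := fun s => by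
    simp only [w]; split
    · exact hH2 i s
    · split_ifs; exacts [hvU i s, le_rfl]
    · split_ifs; exacts [(hTv i s).trans (hvU i s), le_rfl]
  -- one-step analysis
  have hexw : ∀ s (y : S → ℝ), (∀ z, nx (ph s) s (g s) = ph z → w z = y z) →
      ex (G.q s (g s)) w = ex (G.q s (g s)) y := fun s y hy =>
    ex_congr _ (fun z hz => hy z (hph s _ (hg s) z hz).symm)
  have w_none : ∀ z, none = ph z → w z = H i z := fun z hz => by simp only [w, ← hz]
  have w_soft : ∀ z, some (i, false) = ph z → w z = v i z := fun z hz => by simp [w, ← hz]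
  have w_hard : ∀ z, some (i, true) = ph z → w z = T i z := fun z hz => by simp [w, ← hz]
  have w_oth : ∀ z j b, j ≠ i → some (j, b) = ph z → w z = U i z := fun z j b hj hz => by
    cases b <;> simp [w, ← hz, hj]
  have hsup : ∀ s, ex (G.q s (g s)) w ≤ w s ∧
      (ph s = none ∨ ph s = some (i, false) → w s ≤ ex (G.q s (g s)) w →
        g s ∈ C s ∧ (nx (ph s) s (g s) = none ∨ nx (ph s) s (g s) = some (i, false))) := by
    intro s
    rcases hp : ph s with _ | ⟨j, b⟩
    · rw [w_none s hp.symm]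
      by_cases hi : G.ctrl s = i
      · by_cases h1 : g s = f0 s
        · have hn : nx (ph s) s (g s) = none := by simp [nx, hp, h1]
          rw [hexw s (H i) (fun z hz => w_none z (hn ▸ hz)), h1, hH3]
          exact ⟨le_rfl, fun _ _ => ⟨hf0 s, Or.inl (by rw [hp] at hn; rw [← h1]; exact hn)⟩⟩
        · by_cases h2 : g s ∈ C s
          · have hn : nx (ph s) s (g s) = some (i, false) := by simp [nx, hp, h1, h2, hi]
            rw [hexw s (v i) (fun z hz => w_soft z (hn ▸ hz))]
            have := hCe s _ h2
            rw [hi] at this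
            rw [this]
            exact ⟨hH1 i s, fun _ _ => ⟨h2, Or.inr (by rw [hp] at hn; exact hn)⟩⟩
          · have hn : nx (ph s) s (g s) = some (i, true) := by simp [nx, hp, h1, h2, hi]
            rw [hexw s (T i) (fun z hz => w_hard z (hn ▸ hz))]
            have := hCn s _ (hg s) h2
            rw [hi] at this
            have h3 := this.trans_le (hH1 i s)
            exact ⟨h3.le, fun _ h4 => absurd h4 (not_le.2 h3)⟩
      · have h1 : g s = f0 s := by rw [hgi s hi, hfs_none s hp]
        have hn : nx (ph s) s (g s) = none := by simp [nx, hp, h1]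
        rw [hexw s (H i) (fun z hz => w_none z (hn ▸ hz)), h1, hH3]
        exact ⟨le_rfl, fun _ _ => ⟨hf0 s, Or.inl (by rw [hp] at hn; rw [← h1]; exact hn)⟩⟩
    · by_cases hj : j = i
      · subst hj
        cases b
        · rw [w_soft s hp.symm]
          by_cases hi : G.ctrl s = j
          · by_cases h2 : g s ∈ C s
            · have hn : nx (ph s) s (g s) = some (j, false) := by simp [nx, hp, h2]
              rw [hexw s (v j) (fun z hz => w_soft z (hn ▸ hz))]
              have := hCe s _ h2
              rw [hi] at this
              rw [this]
              exact ⟨le_rfl, fun _ _ => ⟨h2, Or.inr (by rw [hp] at hn; exact hn)⟩⟩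
            · have hn : nx (ph s) s (g s) = some (j, true) := by simp [nx, hp, h2, hi]
              rw [hexw s (T j) (fun z hz => w_hard z (hn ▸ hz))]
              have h3 := hCn s _ (hg s) h2
              rw [hi] at h3
              exact ⟨h3.le, fun _ h4 => absurd h4 (not_le.2 h3)⟩
          · have h1 : g s = c j s := by rw [hgi s hi, hfs_soft s j hp hi]
            have hn : nx (ph s) s (g s) = some (j, false) := by simp [nx, hp, hi]
            rw [hexw s (v j) (fun z hz => w_soft z (hn ▸ hz)), h1, hce]
            exact ⟨le_rfl, fun _ _ => ⟨hcC j s, Or.inr (by rw [hp] at hn; rw [← h1]; exact hn)⟩⟩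
        · refine ⟨?_, fun h5 => by simp at h5⟩
          have hn : nx (ph s) s (g s) = some (j, true) := by simp [nx, hp]
          rw [w_hard s hp.symm, hexw s (T j) (fun z hz => w_hard z (hn ▸ hz))]
          by_cases hi : G.ctrl s = j
          · exact (hT j s).2.1 hi _ (hg s)
          · rw [hgi s hi, hfs_hard s j hp hi, hte]
      · refine ⟨?_, fun h5 => by simp [hj] at h5⟩
        have hn : ∃ b', nx (ph s) s (g s) = some (j, b') := by
          cases b
          · by_cases h6 : G.ctrl s = j ∧ g s ∉ C s
            · exact ⟨true, by simp only [nx, hp, if_pos h6]⟩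
            · exact ⟨false, by simp only [nx, hp, if_neg h6]⟩
          · exact ⟨true, by simp only [nx, hp]⟩
        obtain ⟨b', hn⟩ := hn
        rw [w_oth s j b hj hp.symm, hexw s (U i) (fun z hz => w_oth z j b' hj (hn ▸ hz))]
        exact (h i).ex_hi (hg s)
  obtain ⟨x, hx1, hx2, hx3⟩ := exists_harmonic (h i) g le_rfl hLw hwU
    (fun s => (h i).ex_lo (hg s)) (fun s => (hsup s).1)
  have hJg : J g i = x G.init := hJ g hg i x hx1 (hx2.trans hwU) hx3
  have hJ0 : J f0 i = w G.init := by
    rw [w_none _ hph0.symm]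
    exact hJ f0 hf0a i (H i) ((hLv i).trans (hH1 i)) (hH2 i) (hH3 i)
  refine ⟨by rw [hJg, hJ0]; exact hx2 _, fun heq => ?_⟩
  have hxabs := (h i).abs hx1 (hx2.trans hwU)
  have hwabs := (h i).abs hLw hwU
  have hge : ∀ s, x s = w s → w s ≤ ex (G.q s (g s)) w := fun s hs => by
    rw [← hs, ← hx3 s]
    exact ex_mono _ hxabs hwabs (fun z _ => hx2 z)
  have hR : ∀ s, G.Rch g s → x s = w s ∧ (ph s = none ∨ ph s = some (i, false)) := by
    intro s hs
    induction hs with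
    | init => exact ⟨by rw [← hJg, ← hJ0, heq], Or.inl hph0⟩
    | step s z hs hz ih =>
      refine ⟨?_, ?_⟩
      · refine ex_eq_imp (G.q s (g s)) hxabs hwabs (fun z _ => hx2 z) ?_ z hz
        rw [hx3, ih.1]; exact (hsup s).1
      · rw [hph s _ (hg s) z hz]
        exact ((hsup s).2 ih.2 (hge s ih.1)).2
  have hgC : ∀ s, G.Rch g s → g s ∈ C s := fun s hs =>
    ((hsup s).2 (hR s hs).2 (hge s (hR s hs).1)).1
  have hg'C : ∀ s, (fun s => if G.Rch g s then g s else f0 s) s ∈ C s := fun s => by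
    dsimp only; split_ifs with hs; exacts [hgC s hs, hf0 s]
  have := hmin _ hg'C
  rwa [pay_congr h hJ (fun s => hCa s (hg'C s)) hg (fun s hs => if_pos hs)] at this

end

end PGame

namespace PGame

open Filter Topology ProbabilityTheory

section Payoffs

variable {N S A : Type*} (G : PGame N S A)

lemma exists_cyl_subset {O : Set G.Play} (hO : IsOpen O) {p : G.Play} (hp : p ∈ O) :
    ∃ n, G.cylSet p n ⊆ O := by
  letI : TopologicalSpace S := ⊥
  letI : TopologicalSpace A := ⊥
  obtain ⟨V, hV, rfl⟩ := isOpen_induced_iff.1 hO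
  obtain ⟨I, W, hW, hsub⟩ := isOpen_pi_iff.1 hV p.1 hp
  refine ⟨I.sup id + 1, fun p' hp' => hsub fun k hk => ?_⟩
  have : p'.1 k = p.1 k := hp' k (Nat.lt_succ_of_le (Finset.le_sup (f := id) hk))
  change p'.1 k ∈ W k
  rw [this]
  exact (hW k hk).2

lemma isOpen_coord (n : ℕ) (B : Set (S × A)) : IsOpen {p : G.Play | p.1 n ∈ B} := by
  letI : TopologicalSpace S := ⊥
  letI : TopologicalSpace A := ⊥
  haveI : DiscreteTopology S := ⟨rfl⟩
  haveI : DiscreteTopology A := ⟨rfl⟩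
  have hc : Continuous (fun p : {p : ℕ → S × A // G.IsPlay p} => p.1 n) :=
    (continuous_apply n).comp continuous_subtype_val
  exact (isOpen_discrete B).preimage hc

lemma measurableSet_coord (n : ℕ) (B : Set (S × A)) :
    MeasurableSet {p : G.Play | p.1 n ∈ B} := by
  haveI : BorelSpace G.Play := ⟨rfl⟩
  exact (G.isOpen_coord n B).measurableSet

/-- The plays through a state. -/
def Thr (s : S) : Type _ := {p : G.Play // ∃ n, (p.1 n).1 = s}

instance (s : S) : Nonempty (G.Thr s) := by
  obtain ⟨p, hp, hn⟩ := G.exists_play_through s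
  exact ⟨⟨⟨p, hp⟩, hn⟩⟩

/-- Lower bound of the payoff through a state. -/
noncomputable def loB (u : G.Play → ℝ) (s : S) : ℝ := ⨅ p : G.Thr s, u p.1

/-- Upper bound of the payoff through a state. -/
noncomputable def hiB (u : G.Play → ℝ) (s : S) : ℝ := ⨆ p : G.Thr s, u p.1

variable {G}

lemma bdd_lo {u : G.Play → ℝ} {K : ℝ} (hK : ∀ p, |u p| ≤ K) (s : S) :
    BddBelow (Set.range fun p : G.Thr s => u p.1) := by
  refine ⟨-K, ?_⟩
  rintro _ ⟨p, rfl⟩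
  exact (abs_le.1 (hK _)).1

lemma bdd_hi {u : G.Play → ℝ} {K : ℝ} (hK : ∀ p, |u p| ≤ K) (s : S) :
    BddAbove (Set.range fun p : G.Thr s => u p.1) := by
  refine ⟨K, ?_⟩
  rintro _ ⟨p, rfl⟩
  exact (abs_le.1 (hK _)).2

lemma bds {u : G.Play → ℝ} {K : ℝ} (hK : ∀ p, |u p| ≤ K) : G.Bds (G.loB u) (G.hiB u) K where
  lo s := le_ciInf fun p => (abs_le.1 (hK _)).1
  hi s := ciSup_le fun p => (abs_le.1 (hK _)).2
  le s := by
    obtain ⟨p⟩ : Nonempty (G.Thr s) := inferInstance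
    exact (ciInf_le (bdd_lo hK s) p).trans (le_ciSup (bdd_hi hK s) p)
  mono s a z ha hz := by
    have key : ∀ p : G.Thr z, ∃ n, (p.1.1 n).1 = s := by
      rintro ⟨p, n, hn⟩
      cases n with
      | zero =>
        rw [p.2.1] at hn
        subst hn
        exact absurd hz (G.init_not_succ s a ha)
      | succ n =>
        have h1 := p.2.2 n
        rw [hn] at h1
        exact ⟨n, (G.unique_pred z _ _ _ _ h1.1 ha h1.2 hz).1⟩
    exact ⟨le_ciInf fun p => ciInf_le (bdd_lo hK s) ⟨p.1, key p⟩,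
      ciSup_le fun p => le_ciSup (bdd_hi hK s) (⟨p.1, key p⟩ : G.Thr s)⟩

lemma tendsto_play {u : G.Play → ℝ} {K : ℝ} (hK : ∀ p, |u p| ≤ K) (hu : Continuous u)
    {w : S → ℝ} (h1 : G.loB u ≤ w) (h2 : w ≤ G.hiB u) (p : G.Play) :
    Tendsto (fun n => w (p.1 n).1) atTop (𝓝 (u p)) := by
  rw [Metric.tendsto_atTop]
  intro ε hε
  have hO : IsOpen (u ⁻¹' Metric.ball (u p) (ε / 2)) := Metric.isOpen_ball.preimage hu
  obtain ⟨n, hn⟩ := G.exists_cyl_subset hO (p := p) (Metric.mem_ball_self (half_pos hε))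
  refine ⟨n, fun m hm => ?_⟩
  have hthr : ∀ p' : G.Thr (p.1 m).1, |u p'.1 - u p| < ε / 2 := by
    rintro ⟨p', k, hk⟩
    obtain ⟨e, hh⟩ := G.history_unique p.2 p'.2 m k hk.symm
    exact hn (fun j hj => (hh j (by omega)).symm)
  have hlo : u p - ε / 2 ≤ G.loB u (p.1 m).1 :=
    le_ciInf fun p' => by linarith [(abs_lt.1 (hthr p')).1]
  have hhi : G.hiB u (p.1 m).1 ≤ u p + ε / 2 :=
    ciSup_le fun p' => by linarith [(abs_lt.1 (hthr p')).2]
  rw [Real.dist_eq, abs_lt]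
  have := h1 (p.1 m).1
  have := h2 (p.1 m).1
  constructor <;> linarith

lemma playFun_mem (σ : G.Profile) (s : S) : G.playFun σ s ∈ G.act s :=
  (σ (G.ctrl s)).2 s rfl

lemma coord_eq_cyl (p0 : G.Play) (n : ℕ) : {p : G.Play | p.1 n = p0.1 n} = G.cylSet p0 (n + 1) := by
  ext p
  constructor
  · intro hp m hm
    rcases Nat.lt_succ_iff_lt_or_eq.1 hm with hm | rfl
    · exact (G.history_unique p.2 p0.2 n n (congrArg Prod.fst hp)).2 m hm
    · exact hp
  · intro hp
    exact hp n (Nat.lt_succ_self n)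

variable [Countable S] {μ : G.Profile → Measure G.Play}

lemma cyl_zero (hμ : G.IsInducedMeasure μ) (σ : G.Profile) (p0 : G.Play) (n : ℕ)
    (hne : (p0.1 n).2 ≠ G.playFun σ (p0.1 n).1) : μ σ (G.cylSet p0 (n + 1)) = 0 := by
  rw [hμ.2]
  refine Finset.prod_eq_zero (i := n) (Finset.mem_range.2 (Nat.lt_succ_self n)) ?_
  rw [if_neg hne, zero_mul]

lemma cyl_succ (hμ : G.IsInducedMeasure μ) (σ : G.Profile) (p0 : G.Play) (n : ℕ)
    (he : (p0.1 (n + 1)).2 = G.playFun σ (p0.1 (n + 1)).1) :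
    μ σ (G.cylSet p0 (n + 2)) =
      μ σ (G.cylSet p0 (n + 1)) * G.q (p0.1 n).1 (p0.1 n).2 (p0.1 (n + 1)).1 := by
  rw [hμ.2, hμ.2, Finset.prod_range_succ, Finset.prod_range_succ, Finset.prod_range_succ, if_pos he,
    if_neg (by omega : ¬ (n + 1 + 1 < n + 2)), if_pos (by omega : n + 1 < n + 2),
    if_neg (by omega : ¬ (n + 1 < n + 1)), mul_one, mul_one, mul_one, ← mul_assoc]
  congr 2
  refine Finset.prod_congr rfl (fun m hm => ?_)
  rw [Finset.mem_range] at hm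
  rw [if_pos (by omega : m + 1 < n + 2), if_pos (by omega : m + 1 < n + 1)]

lemma ae_action (hμ : G.IsInducedMeasure μ) (σ : G.Profile) (n : ℕ) :
    ∀ᵐ p ∂(μ σ), (p.1 n).2 = G.playFun σ (p.1 n).1 := by
  have hsub : {p : G.Play | ¬ (p.1 n).2 = G.playFun σ (p.1 n).1} ⊆
      ⋃ s : S, ⋃ a ∈ {a | a ∈ G.act s ∧ a ≠ G.playFun σ s}, {p : G.Play | p.1 n = (s, a)} := by
    intro p hp
    simp only [Set.mem_iUnion]
    exact ⟨(p.1 n).1, (p.1 n).2, ⟨(p.2.2 n).1, hp⟩, rfl⟩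
  refine measure_mono_null hsub (measure_iUnion_null fun s => ?_)
  have hfin : {a | a ∈ G.act s ∧ a ≠ G.playFun σ s}.Finite :=
    (G.act s).finite_toSet.subset fun a ha => ha.1
  refine (measure_biUnion_null_iff hfin.countable).2 fun a ha => ?_
  by_cases hex : ∃ p0 : G.Play, p0.1 n = (s, a)
  · obtain ⟨p0, hp0⟩ := hex
    rw [← hp0, coord_eq_cyl]
    refine cyl_zero hμ σ p0 n ?_
    rw [hp0]; exact ha.2
  · have : {p : G.Play | p.1 n = (s, a)} = ∅ :=
      Set.eq_empty_iff_forall_notMem.2 fun p hp => hex ⟨p, hp⟩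
    rw [this, measure_empty]

lemma measure_state (hμ : G.IsInducedMeasure μ) (σ : G.Profile) (p0 : G.Play) (n : ℕ)
    (he : (p0.1 n).2 = G.playFun σ (p0.1 n).1) :
    μ σ {p : G.Play | (p.1 n).1 = (p0.1 n).1} = μ σ (G.cylSet p0 (n + 1)) := by
  rw [← coord_eq_cyl]
  refine measure_congr ?_
  filter_upwards [ae_action hμ σ n] with p hp
  refine propext ⟨fun h => ?_, fun h => congrArg Prod.fst h⟩
  have h' : (p.1 n).1 = (p0.1 n).1 := h
  exact Prod.ext h' (by rw [hp, h', he])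

lemma measure_step (hμ : G.IsInducedMeasure μ) (σ : G.Profile) (n : ℕ) (z : S) :
    μ σ {p : G.Play | (p.1 (n + 1)).1 = z} =
      ∑' s, G.q s (G.playFun σ s) z * μ σ {p : G.Play | (p.1 n).1 = s} := by
  by_cases hex : ∃ p0 : G.Play, (p0.1 (n + 1)).1 = z
  · obtain ⟨p1, hp1⟩ := hex
    obtain ⟨p', h1, h2, h3⟩ := G.exists_ext' p1.2 (n + 1) (G.playFun σ (p1.1 (n + 1)).1)
      (playFun_mem σ _)
    obtain ⟨p0, rfl⟩ : ∃ p0 : G.Play, p0.1 = p' := ⟨⟨p', h1⟩, rfl⟩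
    rw [hp1] at h3
    have hz : (p0.1 (n + 1)).1 = z := by rw [h3]
    have hact : (p0.1 (n + 1)).2 = G.playFun σ (p0.1 (n + 1)).1 := by rw [h3]
    have hL := measure_state hμ σ p0 (n + 1) hact
    rw [cyl_succ hμ σ p0 n hact, hz] at hL
    rw [hL]
    have hpl := p0.2.2 n
    rw [hz] at hpl
    rw [tsum_eq_single (p0.1 n).1]
    · by_cases ha : (p0.1 n).2 = G.playFun σ (p0.1 n).1
      · rw [measure_state hμ σ p0 n ha, ha, mul_comm]
      · rw [cyl_zero hμ σ p0 n ha, zero_mul]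
        symm
        have : G.q (p0.1 n).1 (G.playFun σ (p0.1 n).1) z = 0 := by
          by_contra hne
          exact ha (G.unique_pred z _ _ _ _ hpl.1 (playFun_mem σ _) hpl.2 hne).2
        rw [this, zero_mul]
    · intro s hs
      have : G.q s (G.playFun σ s) z = 0 := by
        by_contra hne
        exact hs (G.unique_pred z _ _ _ _ (playFun_mem σ s) hpl.1 hne hpl.2).1
      rw [this, zero_mul]
  · have h0 : {p : G.Play | (p.1 (n + 1)).1 = z} = ∅ :=
      Set.eq_empty_iff_forall_notMem.2 fun p hp => hex ⟨p, hp⟩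
    rw [h0, measure_empty]
    symm
    rw [ENNReal.tsum_eq_zero]
    intro s
    by_contra hne
    have hq : G.q s (G.playFun σ s) z ≠ 0 := left_ne_zero_of_mul hne
    have hm : μ σ {p : G.Play | (p.1 n).1 = s} ≠ 0 := right_ne_zero_of_mul hne
    obtain ⟨p, hp⟩ := nonempty_of_measure_ne_zero hm
    have hp : (p.1 n).1 = s := hp
    subst hp
    obtain ⟨p', h1, -, -, h4⟩ := G.exists_ext p.2 n _ (playFun_mem σ _) z hq
    exact hex ⟨⟨p', h1⟩, h4⟩

lemma integral_step (hμ : G.IsInducedMeasure μ) (σ : G.Profile) (n : ℕ) {w : S → ℝ} {K : ℝ} (hw : ∀ s, |w s| ≤ K) :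
    ∫ p, w (p.1 (n + 1)).1 ∂(μ σ) =
      ∫ p, ex (G.q (p.1 n).1 (G.playFun σ (p.1 n).1)) w ∂(μ σ) := by
  letI : MeasurableSpace S := ⊤
  haveI := hμ.1 σ
  have hX : ∀ n, Measurable (fun p : G.Play => (p.1 n).1) := fun n B _ =>
    G.measurableSet_coord n (Prod.fst ⁻¹' B)
  let κ : Kernel S S := ⟨fun s => (G.q s (G.playFun σ s)).toMeasure, measurable_from_top⟩
  haveI : IsMarkovKernel κ := ⟨fun s => by
    change IsProbabilityMeasure (G.q s (G.playFun σ s)).toMeasure; infer_instance⟩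
  have hwint : ∀ (ν : Measure S) [IsFiniteMeasure ν], Integrable w ν := fun ν _ =>
    Integrable.of_bound (measurable_from_top.aestronglyMeasurable) K
      (Eventually.of_forall fun s => hw s)
  have hν : (μ σ).map (fun p : G.Play => (p.1 (n + 1)).1) =
      (κ ∘ₖ Kernel.const Unit ((μ σ).map (fun p : G.Play => (p.1 n).1))) () := by
    rw [Kernel.comp_apply, Kernel.const_apply]
    refine Measure.ext_of_singleton fun z => ?_
    rw [Measure.bind_apply (MeasurableSet.of_discrete) κ.measurable.aemeasurable, lintegral_countable',
      Measure.map_apply (hX _) (MeasurableSet.of_discrete)]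
    refine (measure_step hμ σ n z).trans (tsum_congr fun s => ?_)
    rw [Measure.map_apply (hX _) (MeasurableSet.of_discrete)]
    congr 1
    exact ((G.q s (G.playFun σ s)).toMeasure_apply_singleton z (MeasurableSet.of_discrete)).symm
  haveI : IsProbabilityMeasure ((μ σ).map (fun p : G.Play => (p.1 n).1)) :=
    Measure.isProbabilityMeasure_map (hX n).aemeasurable
  haveI : IsProbabilityMeasure ((μ σ).map (fun p : G.Play => (p.1 (n + 1)).1)) :=
    Measure.isProbabilityMeasure_map (hX (n + 1)).aemeasurable
  have e1 : ∫ p, w (p.1 (n + 1)).1 ∂(μ σ) =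
      ∫ s, w s ∂((μ σ).map (fun p : G.Play => (p.1 (n + 1)).1)) :=
    (integral_map (hX _).aemeasurable measurable_from_top.aestronglyMeasurable).symm
  have hi := hwint ((μ σ).map (fun p : G.Play => (p.1 (n + 1)).1))
  rw [e1]
  rw [hν] at hi ⊢
  rw [Kernel.integral_comp hi, Kernel.const_apply,
    integral_map (hX _).aemeasurable measurable_from_top.aestronglyMeasurable]
  refine integral_congr_ae (Eventually.of_forall fun p => ?_)
  change ∫ y, w y ∂((G.q _ (G.playFun σ _)).toMeasure) = _
  rw [PMF.integral_eq_tsum _ _ (hwint _)]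
  rfl

lemma epay_eq (hμ : G.IsInducedMeasure μ) {u : N → G.Play → ℝ} {i : N} {K : ℝ} (hK : ∀ p, |u i p| ≤ K)
    (hu : Continuous (u i)) (σ : G.Profile) {w : S → ℝ}
    (h1 : G.loB (u i) ≤ w) (h2 : w ≤ G.hiB (u i))
    (hw : ∀ s, ex (G.q s (G.playFun σ s)) w = w s) :
    G.epay μ u σ i = w G.init := by
  haveI := hμ.1 σ
  letI : MeasurableSpace S := ⊤
  have habs := (bds hK).abs h1 h2
  have hX : ∀ n, Measurable (fun p : G.Play => w (p.1 n).1) := fun n =>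
    (measurable_from_top (f := w)).comp (fun B _ => G.measurableSet_coord n (Prod.fst ⁻¹' B))
  have hconst : ∀ n, ∫ p, w (p.1 n).1 ∂(μ σ) = w G.init := by
    intro n
    induction n with
    | zero =>
      have : ∀ p : G.Play, w (p.1 0).1 = w G.init := fun p => by rw [p.2.1]
      simp [this]
    | succ n ih =>
      rw [integral_step hμ σ n habs, ← ih]
      simp_rw [hw]
  have hlim : Tendsto (fun n => ∫ p, w (p.1 n).1 ∂(μ σ)) atTop (𝓝 (∫ p, u i p ∂(μ σ))) :=
    tendsto_integral_of_dominated_convergence (fun _ => K)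
      (fun n => (hX n).aestronglyMeasurable) (integrable_const K)
      (fun n => Eventually.of_forall fun p => habs _)
      (Eventually.of_forall fun p => tendsto_play hK hu h1 h2 p)
  simp_rw [hconst] at hlim
  exact tendsto_nhds_unique hlim tendsto_const_nhds


end Payoffs

end PGame

/-- **Nash equilibria secure with respect to a secondary objective `F`**
(lexicographic preferences, Section 6): in a multi-player perfect-information game
with probabilistic transitions, countable state space, nonempty finite action
sets, and bounded continuous payoff functions, for every continuous and bounded
function `F : ℝ^N → ℝ` there exists a Nash equilibrium `σ*` such that any
deviation of a player keeping his own expected payoff equal does not decrease the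
value of `F` at the vector of expected payoffs. -/
theorem exists_nash_secure_for_secondary_objective
    {N S A : Type*} [Finite N] [Countable S]
    (hN : 2 ≤ Nat.card N)
    (G : PGame N S A) (u : N → G.Play → ℝ)
    (hu_bdd : ∀ i : N, ∃ C : ℝ, ∀ p : G.Play, |u i p| ≤ C)
    (hu_cont : ∀ i : N, Continuous (u i))
    (μ : G.Profile → MeasureTheory.Measure G.Play)
    (hμ : G.IsInducedMeasure μ)
    (F : (N → ℝ) → ℝ)
    (hF_cont : Continuous F)
    (hF_bdd : ∃ C : ℝ, ∀ x : N → ℝ, |F x| ≤ C) :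
    ∃ σ : G.Profile, G.IsNash μ u σ ∧
      ∀ (i : N) (τi : G.Strat i),
        G.epay μ u (G.comb i τi σ) i = G.epay μ u σ i →
        F (fun j => G.epay μ u σ j) ≤ F (fun j => G.epay μ u (G.comb i τi σ) j) := by
  choose K hK using hu_bdd
  classical
  let prof : (f : S → A) → (∀ s, f s ∈ G.act s) → G.Profile := fun f hf i => ⟨f, fun s _ => hf s⟩
  let J : (S → A) → N → ℝ := fun f i =>
    if hf : ∀ s, f s ∈ G.act s then G.epay μ u (prof f hf) i else 0
  have hB : ∀ i, G.Bds (G.loB (u i)) (G.hiB (u i)) (K i) := fun i => PGame.bds (hK i)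
  have hJ : G.IsPay (fun i => G.loB (u i)) (fun i => G.hiB (u i)) J := by
    intro f hf i w h1 h2 h3
    simp only [J, dif_pos hf]
    exact PGame.epay_eq hμ (hK i) (hu_cont i) (prof f hf) h1 h2 h3
  have hJe : ∀ σ : G.Profile, ∀ i, G.epay μ u σ i = J (G.playFun σ) i := by
    intro σ i
    obtain ⟨w, h1, h2, h3⟩ := PGame.exists_harm hB (G.playFun σ) (PGame.playFun_mem σ) i
    rw [hJ _ (PGame.playFun_mem σ) i w h1 h2 h3]
    exact PGame.epay_eq hμ (hK i) (hu_cont i) σ h1 h2 h3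
  obtain ⟨f, hf, hmain⟩ := PGame.core_main hB hJ F hF_cont hF_bdd
  have hpf : G.playFun (prof f hf) = f := rfl
  have hdev : ∀ (i : N) (τi : G.Strat i), ∀ s, G.ctrl s ≠ i →
      G.playFun (G.comb i τi (prof f hf)) s = f s := by
    intro i τi s hs
    have h1 : G.comb i τi (prof f hf) (G.ctrl s) = prof f hf (G.ctrl s) := by
      unfold PGame.comb
      exact @Function.update_of_ne N (fun i => G.Strat i) (Classical.decEq N) _ _ hs _ _
    change (G.comb i τi (prof f hf) (G.ctrl s)).1 s = f s
    rw [h1]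
  refine ⟨prof f hf, ?_, ?_⟩
  · intro i τi
    rw [hJe, hJe, hpf]
    exact (hmain i _ (PGame.playFun_mem _) (hdev i τi)).1
  · intro i τi heq
    rw [hJe, hJe, hpf] at heq
    have := (hmain i _ (PGame.playFun_mem _) (hdev i τi)).2 heq
    simp_rw [hJe, hpf]
    exact this
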